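/- Let G be a connected graph of order n with exactly one cut vertex u, and suppose there is a connected component C of G − u with |V(C)| ≥ 3 such that κ(G[V(C) ∪ {u}]) = 2 and for every vertex v ∈ V(C) the pair {u, v} is not a vertex cut set of G[V(C) ∪ {u}]. Then sdiam_{n−3}(G) ≥ n − 2. -/

import Mathlib

open SimpleGraph

/-- The Steiner distance of a vertex set `S` in `G`: the minimum number of edges of a
connected subgraph of `G` whose vertex set contains `S` (`⊤` if no such subgraph exists). -/
noncomputable def steinerDist {V : Type*} (G : SimpleGraph V) (S : Set V) : ℕ∞ :=
  sInf {m : ℕ∞ | ∃ H : G.Subgraph, H.Connected ∧ S ⊆ H.verts ∧ m = H.edgeSet.ncard}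

/-- The Steiner `k`-diameter of `G`: the maximum of `steinerDist G S` over all
`k`-element vertex subsets `S`. -/
noncomputable def sdiam {V : Type*} (G : SimpleGraph V) (k : ℕ) : ℕ∞ :=
  sSup {m : ℕ∞ | ∃ S : Set V, S.ncard = k ∧ m = steinerDist G S}

/-- `v` is a cut vertex of `G` if deleting `v` disconnects `G`. -/
def IsCutVertex {V : Type*} (G : SimpleGraph V) (v : V) : Prop :=
  ¬ (G.induce ({v}ᶜ : Set V)).Connected

/-- `U` is a vertex cut set of the induced subgraph `G[A]` if `U ⊆ A` and deleting `U`
from `G[A]` leaves a disconnected graph. -/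
def IsCutSetOf {V : Type*} (G : SimpleGraph V) (A U : Set V) : Prop :=
  U ⊆ A ∧ ¬ (G.induce (A \ U)).Connected

/-- The vertex connectivity of the induced subgraph `G[A]`: the minimum size of a set
`U ⊆ A` whose removal disconnects `G[A]` or reduces it to a single vertex. -/
noncomputable def kappaOn {V : Type*} (G : SimpleGraph V) (A : Set V) : ℕ :=
  sInf {m : ℕ | ∃ U : Set V, U ⊆ A ∧ U.ncard = m ∧
    (¬ (G.induce (A \ U)).Connected ∨ (A \ U).ncard = 1)}

/-- The vertex connectivity `κ(G)`. -/
noncomputable def kappa {V : Type*} (G : SimpleGraph V) : ℕ :=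
  kappaOn G Set.univ

/-- A set closed under adjacency in a connected subgraph that meets the subgraph contains it. -/
lemma SimpleGraph.Subgraph.Connected.mem_of_adj_closed {V : Type*} {G : SimpleGraph V}
    {H : G.Subgraph} (hH : H.Connected) {P : Set V}
    (hP : ∀ p q, H.Adj p q → p ∈ P → q ∈ P) {x y : V} (hx : x ∈ H.verts) (hxP : x ∈ P)
    (hy : y ∈ H.verts) : y ∈ P := by
  obtain ⟨w⟩ := hH.coe.preconnected ⟨x, hx⟩ ⟨y, hy⟩
  have key : ∀ {s t : H.verts}, H.coe.Walk s t → s.1 ∈ P → t.1 ∈ P := by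
    intro s t w
    induction w with
    | nil => exact id
    | cons h _ ih => exact fun hs => ih (hP _ _ h hs)
  exact key w hxP

/-- A connected subgraph has at most one more vertex than edges. -/
lemma SimpleGraph.Subgraph.Connected.ncard_verts_le {V : Type*} [Finite V] {G : SimpleGraph V}
    {H : G.Subgraph} (hH : H.Connected) : H.verts.ncard ≤ H.edgeSet.ncard + 1 := by
  have h := hH.coe.card_vert_le_card_edgeSet_add_one
  have h2 : Nat.card H.coe.edgeSet ≤ H.edgeSet.ncard := by
    rw [← Nat.card_coe_set_eq H.edgeSet]
    refine Nat.card_le_card_of_injective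
      (fun e => (⟨e.1.map Subtype.val, ?_⟩ : H.edgeSet)) ?_
    · obtain ⟨e, he⟩ := e
      induction e with
      | _ p q => simpa using he
    · intro e f hef
      exact Subtype.ext (Sym2.map.injective Subtype.val_injective (congrArg Subtype.val hef))
  rw [Nat.card_coe_set_eq] at h
  omega

/-- If every connected subgraph containing `S` misses at most one vertex, then the Steiner
distance of `S` is at least the order of the graph minus two. -/
lemma le_steinerDist_of_ncard_compl_le_one {V : Type*} [Fintype V] {G : SimpleGraph V} {S : Set V}
    (h : ∀ H : G.Subgraph, H.Connected → S ⊆ H.verts → H.vertsᶜ.ncard ≤ 1) :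
    (↑(Fintype.card V - 2) : ℕ∞) ≤ steinerDist G S := by
  refine le_sInf ?_
  rintro _ ⟨H, hH, hS, rfl⟩
  have h1 := h H hH hS
  have h2 := hH.ncard_verts_le
  have h3 := Set.ncard_add_ncard_compl H.verts
  rw [Nat.card_eq_fintype_card] at h3
  exact_mod_cast (by omega : Fintype.card V - 2 ≤ H.edgeSet.ncard)

/-- A component of `G - u` is closed under adjacency in `G - u`. -/
lemma mem_component_of_adj {V : Type*} {G : SimpleGraph V} {u : V}
    {c : (G.induce ({u}ᶜ : Set V)).ConnectedComponent} {p q : V} (h : G.Adj p q)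
    (hp : p ∈ Subtype.val '' c.supp) (hq : q ≠ u) : q ∈ Subtype.val '' c.supp := by
  obtain ⟨p, hp, rfl⟩ := hp
  refine ⟨⟨q, hq⟩, ?_, rfl⟩
  exact c.mem_supp_of_adj_mem_supp hp (by simpa using h)

/-- If `u` is a cut vertex then `G - u` has a vertex outside any given component. -/
lemma exists_notMem_component {V : Type*} {G : SimpleGraph V} {u : V} (hu : IsCutVertex G u)
    (c : (G.induce ({u}ᶜ : Set V)).ConnectedComponent) :
    ∃ y, y ≠ u ∧ y ∉ Subtype.val '' c.supp := by
  by_contra! hall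
  refine hu ?_
  obtain ⟨x, hx⟩ := c.nonempty_supp
  have : Nonempty ({u}ᶜ : Set V) := ⟨x⟩
  refine ⟨fun s t => ?_⟩
  have mem : ∀ s : ({u}ᶜ : Set V), s ∈ c.supp := fun s => by
    obtain ⟨s', hs', e⟩ := hall s.1 s.2
    rwa [← Subtype.ext e]
  exact SimpleGraph.ConnectedComponent.exact ((mem s).trans (mem t).symm)

/-- If `A` has at least four vertices and `κ(G[A]) = 2`, then `G[A]` has a vertex cut set
of size two. -/
lemma exists_pair_isCutSetOf {V : Type*} {G : SimpleGraph V} {A : Set V}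
    (hA : 4 ≤ A.ncard) (hκ : kappaOn G A = 2) : ∃ a b, a ≠ b ∧ IsCutSetOf G A {a, b} := by
  obtain ⟨U, hUA, hU, h⟩ := Nat.sInf_mem (Nat.nonempty_of_sInf_eq_succ hκ)
  change U.ncard = kappaOn G A at hU
  rw [hκ] at hU
  have hUfin : U.Finite := Set.finite_of_ncard_ne_zero (by omega)
  have hd := Set.ncard_sdiff hUA hUfin
  obtain ⟨a, b, hab, rfl⟩ := Set.ncard_eq_two.mp hU
  exact ⟨a, b, hab, hUA, h.resolve_right (by omega)⟩

/-- If `G[A] - U` is disconnected and contains `u`, and `u` is the only vertex of `A` with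
neighbours outside `A`, then no connected subgraph avoiding `U` contains `u` together with all
other vertices of `A \ U`. -/
lemma not_connected_of_isCutSetOf {V : Type*} {G : SimpleGraph V} {A U : Set V} {u : V}
    (hcut : IsCutSetOf G A U) (hu : u ∈ A \ U)
    (hA : ∀ p q, G.Adj p q → p ∈ A → p ≠ u → q ∈ A)
    {H : G.Subgraph} (hAH : A \ U ⊆ H.verts) (hUH : Disjoint U H.verts) : ¬ H.Connected := by
  intro hH
  refine hcut.2 ?_
  have : Nonempty ↥(A \ U) := ⟨⟨u, hu⟩⟩
  have reach : ∀ y, (G.induce (A \ U)).Reachable ⟨u, hu⟩ y := by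
    intro y
    by_contra hy
    have huP := hH.mem_of_adj_closed
      (P := Subtype.val '' {z | ¬ (G.induce (A \ U)).Reachable ⟨u, hu⟩ z}) ?_
      (hAH y.2) ⟨y, hy, rfl⟩ (hAH hu)
    · obtain ⟨z, hz, e⟩ := huP
      obtain rfl : z = ⟨u, hu⟩ := Subtype.ext e
      exact hz .rfl
    · rintro _ q hpq ⟨p, hp, rfl⟩
      have hpu : p.1 ≠ u := fun e => hp (by
        obtain rfl : p = ⟨u, hu⟩ := Subtype.ext e
        exact .rfl)
      have hq : q ∈ A \ U :=
        ⟨hA _ _ hpq.adj_sub p.2.1 hpu, fun h => hUH.notMem_of_mem_left h hpq.snd_mem⟩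
      refine ⟨⟨q, hq⟩, fun hr => hp (hr.trans ?_), rfl⟩
      exact SimpleGraph.Adj.reachable (by simpa using hpq.adj_sub.symm)
  exact ⟨fun s t => (reach s).symm.trans (reach t)⟩

/-- If `G` is connected of order `n` with exactly one cut vertex `u`, and
some component `C` of `G - u` with `|V(C)| ≥ 3` satisfies `κ(G[V(C) ∪ {u}]) = 2` and no
pair `{u, v}` with `v ∈ V(C)` is a vertex cut set of `G[V(C) ∪ {u}]`, then
`sdiam_{n-3}(G) ≥ n - 2`. -/
theorem sdiam_ge_of_unique_cut {V : Type*} [Fintype V] (G : SimpleGraph V)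
    (hG : G.Connected) (n : ℕ) (hn : Fintype.card V = n)
    (u : V) (hu : IsCutVertex G u) (huniq : ∀ w : V, IsCutVertex G w → w = u)
    (c : (G.induce ({u}ᶜ : Set V)).ConnectedComponent)
    (C : Set V) (hC : C = Subtype.val '' c.supp) (hC3 : 3 ≤ C.ncard)
    (hκ : kappaOn G (C ∪ {u}) = 2)
    (hnocut : ∀ v ∈ C, ¬ IsCutSetOf G (C ∪ {u}) {u, v}) :
    (↑(n - 2) : ℕ∞) ≤ sdiam G (n - 3) := by
  subst hC hn
  set C : Set V := Subtype.val '' c.supp with hC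
  have huC : u ∉ C := by
    rintro ⟨x, -, e⟩
    exact x.2 e
  have hAcard : (C ∪ {u}).ncard = C.ncard + 1 := by
    rw [Set.union_singleton, Set.ncard_insert_of_notMem huC]
  obtain ⟨a, b, hab, hcut⟩ := exists_pair_isCutSetOf (by omega) hκ
  have hua : u ≠ a := by
    rintro rfl
    have hb : b ∈ C := (hcut.1 (by simp)).resolve_right (fun h => hab h.symm)
    exact hnocut b hb hcut
  have hub : u ≠ b := by
    rintro rfl
    have ha : a ∈ C := (hcut.1 (by simp)).resolve_right hab
    exact hnocut a ha (Set.pair_comm a u ▸ hcut)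
  have haC : a ∈ C := (hcut.1 (by simp)).resolve_right hua.symm
  have hbC : b ∈ C := (hcut.1 (by simp)).resolve_right hub.symm
  obtain ⟨y, hyu, hyC⟩ := exists_notMem_component hu c
  obtain ⟨x, hxC, hxab⟩ : ∃ x ∈ C, x ∉ ({a, b} : Set V) :=
    Set.exists_mem_notMem_of_ncard_lt_ncard (by rw [Set.ncard_pair hab]; omega)
  have hT : ({u, a, b} : Set V).ncard = 3 := Set.ncard_eq_three.mpr ⟨u, a, b, hua, hub, hab, rfl⟩
  refine (le_steinerDist_of_ncard_compl_le_one (S := {u, a, b}ᶜ) ?_).trans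
    (le_sSup ⟨_, by rw [Set.ncard_compl, hT, Nat.card_eq_fintype_card], rfl⟩)
  intro H hH hS
  by_contra! hlt
  have hmem : ∀ z, z ≠ u → z ≠ a → z ≠ b → z ∈ H.verts := fun z h1 h2 h3 => hS (by simp [*])
  obtain ⟨hxa, hxb⟩ : x ≠ a ∧ x ≠ b := by simpa using hxab
  by_cases huH : u ∈ H.verts
  · have hsub : H.vertsᶜ ⊆ {a, b} := fun z hz => by
      by_contra hzab
      obtain ⟨h1, h2⟩ : z ≠ a ∧ z ≠ b := by simpa using hzab
      exact hz (hmem z (fun e => hz (e ▸ huH)) h1 h2)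
    have heq : H.vertsᶜ = {a, b} :=
      Set.eq_of_subset_of_ncard_le hsub (by rw [Set.ncard_pair hab]; omega)
    refine not_connected_of_isCutSetOf (u := u) hcut ⟨by simp, by simp [hua, hub]⟩ ?_ ?_ ?_ hH
    · intro p q hpq hp hpu
      by_cases hqu : q = u
      · exact .inr hqu
      · exact .inl (mem_component_of_adj hpq (hp.resolve_right hpu) hqu)
    · rintro z ⟨-, hz⟩
      rw [← heq] at hz
      exact not_not.mp hz
    · rw [← heq]
      exact disjoint_compl_left
  · refine hyC (hH.mem_of_adj_closed (P := C) ?_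
      (hmem x (fun e => huC (e ▸ hxC)) hxa hxb) hxC
      (hmem y hyu (fun e => hyC (e ▸ haC)) (fun e => hyC (e ▸ hbC))))
    exact fun p q hpq hp =>
      mem_component_of_adj hpq.adj_sub hp (fun e => huH (e ▸ hpq.snd_mem))
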